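/- Let r ≥ 2 be an integer and g ∈ ℝ[z_1,…,z_n] be a multi-affine polynomial. Then g_r(x) = (1/(r−1)!)^n · [ (Π_{i=1}^n ∂_i^{r−1}) g(z)^r ] evaluated at z = (x,…,x), where g_r = Σ_{𝒮 ∈ 𝒫_r(n)} g_𝒮. -/

import Mathlib

open MvPolynomial Polynomial

/-- A polynomial with real coefficients is *real stable* if it does not vanish
when all variables have positive imaginary part. -/
def RealStable {n : ℕ} (p : MvPolynomial (Fin n) ℝ) : Prop :=
  ∀ z : Fin n → ℂ, (∀ i, 0 < (z i).im) →
    MvPolynomial.eval z (MvPolynomial.map (algebraMap ℝ ℂ) p) ≠ 0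

/-- A polynomial is *multi-affine* if it has degree at most 1 in each variable. -/
def MultiAffine {n : ℕ} (p : MvPolynomial (Fin n) ℝ) : Prop :=
  ∀ i, p.degreeOf i ≤ 1

/-- The diagonalization `p̄(x) = p(x,…,x)` of a multivariate polynomial. -/
noncomputable def diagPoly {n : ℕ} (p : MvPolynomial (Fin n) ℝ) : Polynomial ℝ :=
  MvPolynomial.aeval (fun _ => Polynomial.X) p

/-- The exponent of the multi-affine monomial `∏_{i ∈ A} z_i`. -/
noncomputable def expOf {n : ℕ} (A : Finset (Fin n)) : Fin n →₀ ℕ :=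
  ∑ i ∈ A, Finsupp.single i 1

/-- `∂^S p = (∏_{i ∈ S} ∂/∂z_i) p`. -/
noncomputable def pderivs {n : ℕ} (S : Finset (Fin n)) (p : MvPolynomial (Fin n) ℝ) :
    MvPolynomial (Fin n) ℝ :=
  S.toList.foldr (fun i q => MvPolynomial.pderiv i q) p

open scoped Classical in
/-- `𝒫_r(n)`: ordered partitions of `[n]` into `r` possibly empty subsets. -/
noncomputable def Partitions (r n : ℕ) : Finset (Fin r → Finset (Fin n)) :=
  Finset.univ.filter
    (fun S => (∀ i j, i ≠ j → Disjoint (S i) (S j)) ∧ ∀ k, ∃ i, k ∈ S i)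

/-- `g_𝒮(x) = ∏_{i=1}^r (diagonalization of ∂^{S_i^c} g)(x)`. -/
noncomputable def gPart {n r : ℕ} (g : MvPolynomial (Fin n) ℝ)
    (S : Fin r → Finset (Fin n)) : Polynomial ℝ :=
  ∏ i, diagPoly (pderivs (S i)ᶜ g)

/-- `g_r = Σ_{𝒮 ∈ 𝒫_r(n)} g_𝒮`. -/
noncomputable def gSum (r : ℕ) {n : ℕ} (g : MvPolynomial (Fin n) ℝ) : Polynomial ℝ :=
  ∑ S ∈ Partitions r n, gPart g S

/-- `∂_j^m p`. -/
noncomputable def pderivPow {n : ℕ} (j : Fin n) (m : ℕ) (p : MvPolynomial (Fin n) ℝ) :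
    MvPolynomial (Fin n) ℝ :=
  (fun q => MvPolynomial.pderiv j q)^[m] p

/-- `(∏_{i=1}^n ∂_i^m) p`. -/
noncomputable def pderivsAllPow {n : ℕ} (m : ℕ) (p : MvPolynomial (Fin n) ℝ) :
    MvPolynomial (Fin n) ℝ :=
  (List.finRange n).foldr (fun k q => pderivPow k m q) p

theorem Derivation.iterate_mul_of_apply_apply_eq_zero {A : Type*} [CommRing A]
    (D : Derivation ℤ A A) {u : A} (hu : D (D u) = 0) (v : A) (m : ℕ) :
    D^[m + 1] (u * v) = u * D^[m + 1] v + (m + 1) * D u * D^[m] v := by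
  induction m with
  | zero => simp [mul_comm]
  | succ m ih =>
    have hm : D (m + 1 : A) = 0 := by exact_mod_cast D.map_natCast (m + 1)
    rw [Function.iterate_succ_apply', ih]
    simp only [map_add, D.leibniz, smul_eq_mul, hu, hm, Function.iterate_succ_apply']
    push_cast
    ring

theorem Derivation.apply_prod_eq_zero {A ι : Type*} [CommRing A] [DecidableEq ι]
    (D : Derivation ℤ A A) {f : ι → A} (hf : ∀ i, D (f i) = 0) (s : Finset ι) :
    D (∏ i ∈ s, f i) = 0 := by
  induction s using Finset.induction_on with
  | empty => simp
  | insert a s ha ih => simp [Finset.prod_insert ha, D.leibniz, hf, ih]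

/-- If `D` kills each `D (f i)`, the `m`-th and `(m - 1)`-st iterates of `D` on a product of `m`
factors `f i` are given by the top terms of the Leibniz rule. -/
theorem Derivation.iterate_prod_of_apply_apply_eq_zero {A ι : Type*} [CommRing A] [DecidableEq ι]
    (D : Derivation ℤ A A) {f : ι → A} (hf : ∀ i, D (D (f i)) = 0) (s : Finset ι) :
    D^[s.card] (∏ i ∈ s, f i) = s.card.factorial * ∏ i ∈ s, D (f i) ∧
      s.card * D^[s.card - 1] (∏ i ∈ s, f i) =
        s.card.factorial * ∑ j ∈ s, ∏ i ∈ s, if i = j then f i else D (f i) := by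
  induction s using Finset.induction_on with
  | empty => simp
  | insert a s ha ih =>
    obtain ⟨ih₁, ih₂⟩ := ih
    have hzero : D^[s.card + 1] (∏ i ∈ s, f i) = 0 := by
      rw [Function.iterate_succ_apply', ih₁, D.leibniz, D.map_natCast,
        D.apply_prod_eq_zero hf]
      simp
    rw [Finset.card_insert_of_notMem ha, Finset.prod_insert ha, Finset.prod_insert ha]
    refine ⟨?_, ?_⟩
    · rw [D.iterate_mul_of_apply_apply_eq_zero (hf a), hzero, ih₁, Nat.factorial_succ]
      push_cast
      ring
    · have hpred : D^[s.card] (f a * ∏ i ∈ s, f i) = f a * D^[s.card] (∏ i ∈ s, f i) +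
          D (f a) * (s.card * D^[s.card - 1] (∏ i ∈ s, f i)) := by
        cases hs : s.card with
        | zero => simp
        | succ m =>
          rw [D.iterate_mul_of_apply_apply_eq_zero (hf a)]
          push_cast
          ring_nf
      have hself : (∏ i ∈ s, if i = a then f i else D (f i)) = ∏ i ∈ s, D (f i) :=
        Finset.prod_congr rfl fun i hi => if_neg (ne_of_mem_of_not_mem hi ha)
      have hother : (∑ j ∈ s, ∏ i ∈ insert a s, if i = j then f i else D (f i)) =
          D (f a) * ∑ j ∈ s, ∏ i ∈ s, if i = j then f i else D (f i) := by
        rw [Finset.mul_sum]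
        refine Finset.sum_congr rfl fun j hj => ?_
        rw [Finset.prod_insert ha, if_neg (ne_of_mem_of_not_mem hj ha).symm]
      rw [Finset.sum_insert ha, hother, Finset.prod_insert ha, if_pos rfl, hself,
        Nat.add_sub_cancel, hpred, ih₁, ih₂, Nat.factorial_succ]
      push_cast
      ring

namespace MvPolynomial

theorem pderiv_comm {σ R : Type*} [CommSemiring R] (i j : σ) (p : MvPolynomial σ R) :
    pderiv i (pderiv j p) = pderiv j (pderiv i p) := by
  classical
  ext m
  simp only [coeff_pderiv, Finsupp.add_apply, Finsupp.single_apply]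
  rw [add_right_comm]
  by_cases h : i = j
  · subst h; rfl
  · simp only [if_neg h, if_neg (Ne.symm h)]
    push_cast
    ring

theorem pderiv_pderiv_eq_zero {σ R : Type*} [CommSemiring R] {p : MvPolynomial σ R} {k : σ}
    (h : p.degreeOf k ≤ 1) : pderiv k (pderiv k p) = 0 := by
  classical
  ext m
  have hm : coeff (m + Finsupp.single k 1 + Finsupp.single k 1) p = 0 := by
    by_contra hne
    have := (monomial_le_degreeOf k (mem_support_iff.2 hne)).trans h
    simp at this
  simp [coeff_pderiv, hm]

theorem pderiv_iterate_prod {σ : Type*} {r : ℕ} (hr : r ≠ 0) (k : σ)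
    {f : Fin r → MvPolynomial σ ℝ} (hf : ∀ i, pderiv k (pderiv k (f i)) = 0) :
    (pderiv k)^[r - 1] (∏ i, f i) =
      ((r - 1).factorial : MvPolynomial σ ℝ) *
        ∑ j, ∏ i, if i = j then f i else pderiv k (f i) := by
  have h := (((pderiv k).restrictScalars ℤ).iterate_prod_of_apply_apply_eq_zero
    (f := f) hf Finset.univ).2
  rw [Finset.card_univ, Fintype.card_fin] at h
  have hr' : (r : MvPolynomial σ ℝ) ≠ 0 := Nat.cast_ne_zero.2 hr
  refine mul_left_cancel₀ hr' (h.trans ?_)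
  rw [← Nat.mul_factorial_pred hr]
  push_cast
  rw [mul_assoc]
  rfl

/-- Differentiate `p` along all the variables `e k` with `c k ≠ i`. -/
noncomputable def pderivsNe {σ ι : Type*} [DecidableEq ι] {m : ℕ} (e : Fin m → σ)
    (c : Fin m → ι) (i : ι) (p : MvPolynomial σ ℝ) : MvPolynomial σ ℝ :=
  (List.ofFn fun k => (e k, c k)).foldr (fun a q => if a.2 = i then q else pderiv a.1 q) p

theorem pderiv_pderiv_pderivsNe {σ ι : Type*} [DecidableEq ι] {m : ℕ} (e : Fin m → σ)
    (c : Fin m → ι) (i : ι) {p : MvPolynomial σ ℝ} {k : σ} (hp : pderiv k (pderiv k p) = 0) :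
    pderiv k (pderiv k (pderivsNe e c i p)) = 0 := by
  unfold pderivsNe
  generalize (List.ofFn fun k => (e k, c k)) = l
  induction l with
  | nil => exact hp
  | cons a l ih =>
    rw [List.foldr_cons]
    split_ifs
    · exact ih
    · rw [pderiv_comm k a.1, pderiv_comm k a.1, ih, map_zero]

theorem foldr_pderiv_iterate_prod {σ : Type*} {r : ℕ} (hr : r ≠ 0) {m : ℕ} (e : Fin m → σ)
    {f : Fin r → MvPolynomial σ ℝ} (hf : ∀ k i, pderiv k (pderiv k (f i)) = 0) :
    (List.ofFn e).foldr (fun k q => (pderiv k)^[r - 1] q) (∏ i, f i) =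
      ((r - 1).factorial : MvPolynomial σ ℝ) ^ m *
        ∑ c : Fin m → Fin r, ∏ i, pderivsNe e c i (f i) := by
  induction m with
  | zero => simp [pderivsNe]
  | succ m ih =>
    rw [List.ofFn_succ, List.foldr_cons, ih]
    let T : Module.End ℝ (MvPolynomial σ ℝ) := (pderiv (e 0)).toLinearMap ^ (r - 1)
    have hT : ∀ q, (pderiv (e 0))^[r - 1] q = T q := fun q =>
      (Module.End.pow_apply (pderiv (e 0)).toLinearMap (r - 1) q).symm
    have hmul : ∀ (N : ℕ) (q : MvPolynomial σ ℝ), T (N * q) = N * T q := fun N q => by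
      simp only [← nsmul_eq_mul, map_nsmul]
    rw [← Nat.cast_pow, hT, hmul, map_sum, ← (Fin.consEquiv fun _ => Fin r).sum_comp,
      Fintype.sum_prod_type_right, pow_succ, mul_assoc, Nat.cast_pow, Finset.mul_sum _ _
        ((r - 1).factorial : MvPolynomial σ ℝ)]
    congr 1
    refine Finset.sum_congr rfl fun c _ => ?_
    rw [← hT, pderiv_iterate_prod hr _ fun i => pderiv_pderiv_pderivsNe _ c i (hf (e 0) i)]
    congr 1
    refine Finset.sum_congr rfl fun j _ => Finset.prod_congr rfl fun i _ => ?_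
    simp [pderivsNe, List.ofFn_succ, Fin.consEquiv, eq_comm]

end MvPolynomial

theorem pderivsNe_id {n r : ℕ} (c : Fin n → Fin r) (i : Fin r) (p : MvPolynomial (Fin n) ℝ) :
    MvPolynomial.pderivsNe id c i p = pderivs (Finset.univ.filter fun k => c k = i)ᶜ p := by
  have h : (List.ofFn fun k => (k, c k)) = (List.finRange n).map fun k => (k, c k) := by
    rw [List.ofFn_eq_map]
  have hperm : ((List.finRange n).filter fun k => !decide (c k = i)).Perm
      (Finset.univ.filter fun k => c k = i)ᶜ.toList :=
    (List.perm_ext_iff_of_nodup ((List.nodup_finRange n).filter _) (Finset.nodup_toList _)).2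
      (by simp)
  unfold MvPolynomial.pderivsNe pderivs
  rw [← hperm.foldr_eq' (f := fun k q => MvPolynomial.pderiv k q)
    (fun x _ y _ z => MvPolynomial.pderiv_comm y x z), List.foldr_filter]
  simp only [id, h, List.foldr_map]
  congr 1
  ext1 k
  ext1 q
  by_cases hk : c k = i <;> simp [hk]

theorem sum_Partitions {M : Type*} [AddCommMonoid M] (r n : ℕ)
    (F : (Fin r → Finset (Fin n)) → M) :
    ∑ S ∈ Partitions r n, F S =
      ∑ c : Fin n → Fin r, F fun i => Finset.univ.filter fun k => c k = i := by
  classical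
  symm
  refine Finset.sum_bij (fun c _ i => Finset.univ.filter fun k => c k = i) ?_ ?_ ?_ ?_
  · intro c _
    simp only [Partitions, Finset.mem_filter, Finset.mem_univ, true_and]
    refine ⟨fun i j hij => Finset.disjoint_filter.2 fun k _ h h' => hij (h.symm.trans h'), ?_⟩
    exact fun k => ⟨c k, rfl⟩
  · intro c _ c' _ h
    ext1 k
    have hk : k ∈ Finset.univ.filter fun l => c' l = c k := by
      rw [← congrFun h (c k)]
      simp
    exact (Finset.mem_filter.1 hk).2.symm
  · intro S hS
    simp only [Partitions, Finset.mem_filter, Finset.mem_univ, true_and] at hS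
    obtain ⟨hdisj, hcov⟩ := hS
    choose c hc using hcov
    refine ⟨c, Finset.mem_univ _, ?_⟩
    ext i k
    simp only [Finset.mem_filter, Finset.mem_univ, true_and]
    refine ⟨fun h => h ▸ hc k, fun h => ?_⟩
    by_contra hne
    exact Finset.disjoint_left.1 (hdisj _ _ hne) (hc k) h
  · intro _ _
    rfl

theorem eval_diagPoly {n : ℕ} (p : MvPolynomial (Fin n) ℝ) (x : ℝ) :
    (diagPoly p).eval x = MvPolynomial.eval (fun _ => x) p := by
  unfold diagPoly
  induction p using MvPolynomial.induction_on with
  | C a => simp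
  | add p q hp hq => simp [hp, hq]
  | mul_X p i hp => simp [hp]

theorem stmt4 (r : ℕ) (hr : 2 ≤ r) (n : ℕ) (g : MvPolynomial (Fin n) ℝ)
    (hma : MultiAffine g) :
    ∀ x : ℝ, Polynomial.eval x (gSum r g) =
      (1 / ((r - 1).factorial : ℝ)) ^ n *
        MvPolynomial.eval (fun _ => x) (pderivsAllPow (r - 1) (g ^ r)) := by
  intro x
  have hpow : pderivsAllPow (r - 1) (g ^ r) =
      ((r - 1).factorial : MvPolynomial (Fin n) ℝ) ^ n *
        ∑ c : Fin n → Fin r, ∏ i, MvPolynomial.pderivsNe id c i g := by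
    rw [← MvPolynomial.foldr_pderiv_iterate_prod (by lia) id fun k _ =>
      MvPolynomial.pderiv_pderiv_eq_zero (hma k)]
    simp [pderivsAllPow, pderivPow, List.ofFn_id]
  have hfac : ((r - 1).factorial : ℝ) ≠ 0 := by positivity
  rw [hpow, gSum, sum_Partitions, Polynomial.eval_finsetSum, map_mul, map_pow, map_natCast,
    ← mul_assoc, ← mul_pow, one_div_mul_cancel hfac, one_pow, one_mul, map_sum]
  refine Finset.sum_congr rfl fun c _ => ?_
  rw [gPart, Polynomial.eval_prod, map_prod]
  exact Finset.prod_congr rfl fun i _ => by rw [eval_diagPoly, pderivsNe_id]
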